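/- Let 𝕏 be a real n×p matrix, ℤ a real m×p matrix, and R a real symmetric positive semidefinite m×m matrix. Set P_pred := 𝕏 𝕏ᵀ, P_{xz} := 𝕏 ℤᵀ, R_e := ℤ ℤᵀ + R, assume R_e is invertible, and define K := P_{xz} R_e⁻¹. Then the filtered covariance P_pred − K R_e Kᵀ is symmetric and positive semidefinite. -/

import Mathlib

open Matrix

/-- With `P_pred = 𝕏 𝕏ᵀ`, `P_{xz} = 𝕏 ℤᵀ`, `R_e = ℤ ℤᵀ + R` invertible
(`R` symmetric positive semidefinite) and gain `K = P_{xz} R_e⁻¹`, the filtered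
covariance `P_pred − K R_e Kᵀ` is symmetric and positive semidefinite. -/
theorem filtered_covariance_posSemidef
    {n m p : ℕ}
    (X : Matrix (Fin n) (Fin p) ℝ)
    (Z : Matrix (Fin m) (Fin p) ℝ)
    (R : Matrix (Fin m) (Fin m) ℝ) (hR : R.PosSemidef)
    (Ppred : Matrix (Fin n) (Fin n) ℝ) (hPpred : Ppred = X * Xᵀ)
    (Pxz : Matrix (Fin n) (Fin m) ℝ) (hPxz : Pxz = X * Zᵀ)
    (Re : Matrix (Fin m) (Fin m) ℝ) (hRe : Re = Z * Zᵀ + R)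
    (hReInv : IsUnit Re)
    (K : Matrix (Fin n) (Fin m) ℝ) (hK : K = Pxz * Re⁻¹) :
    (Ppred - K * Re * Kᵀ).IsSymm ∧ (Ppred - K * Re * Kᵀ).PosSemidef := by
  have hdet : IsUnit Re.det := (Matrix.isUnit_iff_isUnit_det Re).mp hReInv
  have hRs : Rᵀ = R := by
    have h := hR.isHermitian.eq
    rwa [Matrix.conjTranspose_eq_transpose_of_trivial] at h
  have hRes : Reᵀ = Re := by
    rw [hRe, Matrix.transpose_add, Matrix.transpose_mul, Matrix.transpose_transpose, hRs]
  have h1 : K * Re = X * Zᵀ := by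
    rw [hK, hPxz, Matrix.nonsing_inv_mul_cancel_right _ _ hdet]
  have h2 : Re * Kᵀ = Z * Xᵀ := by
    have h := congrArg Matrix.transpose h1
    rwa [Matrix.transpose_mul, Matrix.transpose_mul, Matrix.transpose_transpose, hRes] at h
  -- Joseph form of the covariance update
  have key : Ppred - K * Re * Kᵀ = (X - K * Z) * (X - K * Z)ᵀ + K * R * Kᵀ := by
    have h3 : K * (Z * Xᵀ) = K * Re * Kᵀ := by rw [← h2, Matrix.mul_assoc]
    have h4 : X * (Zᵀ * Kᵀ) = K * Re * Kᵀ := by rw [h1, Matrix.mul_assoc]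
    have h5 : K * R * Kᵀ = K * Re * Kᵀ - K * (Z * (Zᵀ * Kᵀ)) := by
      rw [hRe]
      simp only [Matrix.mul_add, Matrix.add_mul, Matrix.mul_assoc]
      abel
    rw [h5, hPpred, Matrix.transpose_sub, Matrix.transpose_mul, Matrix.sub_mul,
      Matrix.mul_sub, Matrix.mul_sub, h4, Matrix.mul_assoc K Z, Matrix.mul_assoc K Z, h3]
    abel
  have hpsd : (Ppred - K * Re * Kᵀ).PosSemidef := by
    rw [key]
    have a := Matrix.posSemidef_self_mul_conjTranspose (X - K * Z)
    have b := hR.mul_mul_conjTranspose_same K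
    rw [Matrix.conjTranspose_eq_transpose_of_trivial] at a b
    exact a.add b
  refine ⟨?_, hpsd⟩
  have h := hpsd.isHermitian.eq
  rwa [Matrix.conjTranspose_eq_transpose_of_trivial] at h
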